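/- For every c ∈ (0, (c₀/(2π))²] and every θ ∈ (0,π], the series ∑_{n≥1} G_n(θ)·S(c)^n is summable with sum (√c/θ)·J₁(2θ√c); for θ = 0 the sum equals c. In particular, setting Z(x) := ∑_{n≥1} G_n(0)·x^n, one has S(Z(x)) = x for every x ∈ (0, x_c], where x_c := c₀·J₁(c₀)/(2π²). (Zograf's theorem in generating-function form, Theorem 3.2 / equation (eq:Fxtheta) of the paper.) -/

import Mathlib

open MeasureTheory Real

noncomputable def J0 (x : ℝ) : ℝ :=
  ∑' k : ℕ, (-1 : ℝ) ^ k * (x / 2) ^ (2 * k) / ((Nat.factorial k : ℝ)) ^ 2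

noncomputable def J1 (x : ℝ) : ℝ :=
  ∑' k : ℕ, (-1 : ℝ) ^ k * (x / 2) ^ (2 * k + 1) /
    ((Nat.factorial k : ℝ) * (Nat.factorial (k + 1) : ℝ))

noncomputable def c0 : ℝ := sInf {x : ℝ | 0 < x ∧ J0 x = 0}

inductive BinTree : Type
  | leaf : BinTree
  | node : BinTree → BinTree → BinTree

def BinTree.leaves : BinTree → ℕ
  | .leaf => 1
  | .node l r => l.leaves + r.leaves

noncomputable def mAngle : BinTree → ℝ → ℝ
  | .leaf, _ => 1
  | .node l r, θ =>
      ∫ α in (0:ℝ)..Real.pi, ∫ β in (0:ℝ)..Real.pi,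
        if θ < α + β ∧ α + β < Real.pi then mAngle l α * mAngle r β else 0

noncomputable def G (n : ℕ) (θ : ℝ) : ℝ :=
  ∑' τ : {τ : BinTree // τ.leaves = n}, mAngle τ.1 θ

noncomputable def Sfun (y : ℝ) : ℝ := Real.sqrt y / Real.pi * J1 (2 * Real.pi * Real.sqrt y)

noncomputable def xc : ℝ := c0 * J1 c0 / (2 * Real.pi ^ 2)

open Filter Topology Set

namespace Zograf

/-! ### Bessel series -/

/-- Coefficients of `z ↦ ∑ (-1)^k z^k / (k! (k+1)!)`. -/
noncomputable def coeff (k : ℕ) : ℝ :=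
  (-1) ^ k / ((Nat.factorial k : ℝ) * (Nat.factorial (k + 1) : ℝ))

/-- The entire function with `J₁ x = (x / 2) * bes (x² / 4)`. -/
noncomputable def bes (z : ℝ) : ℝ := ∑' k : ℕ, coeff k * z ^ k

/-- The entire function with `J₀ x = bes0 (x² / 4)`. -/
noncomputable def bes0 (z : ℝ) : ℝ := ∑' k : ℕ, (-1) ^ k / (Nat.factorial k : ℝ) ^ 2 * z ^ k

lemma one_le_factorial (k : ℕ) : (1 : ℝ) ≤ (Nat.factorial k : ℝ) :=
  mod_cast Nat.one_le_iff_ne_zero.2 (Nat.factorial_ne_zero k)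

lemma abs_coeff_le (k : ℕ) : |coeff k| ≤ 1 / (Nat.factorial k : ℝ) := by
  have h := one_le_factorial k
  have h' := one_le_factorial (k + 1)
  rw [coeff, abs_div, abs_pow, abs_neg, abs_one, one_pow, abs_of_pos (by positivity)]
  exact one_div_le_one_div_of_le (by positivity) (by nlinarith)

lemma abs_coeff_zero_le (k : ℕ) :
    |(-1) ^ k / (Nat.factorial k : ℝ) ^ 2| ≤ 1 / (Nat.factorial k : ℝ) := by
  have h := one_le_factorial k
  rw [abs_div, abs_pow, abs_neg, abs_one, one_pow, abs_of_pos (by positivity)]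
  exact one_div_le_one_div_of_le (by positivity) (by nlinarith)

section PowerSeries

variable {e : ℕ → ℝ} (he : ∀ k, |e k| ≤ 1 / (Nat.factorial k : ℝ))
include he

lemma norm_mul_pow_le {R z : ℝ} (hz : |z| ≤ R) (k : ℕ) :
    ‖e k * z ^ k‖ ≤ R ^ k / (Nat.factorial k : ℝ) := by
  rw [norm_mul, norm_pow, Real.norm_eq_abs, Real.norm_eq_abs]
  calc |e k| * |z| ^ k ≤ 1 / (Nat.factorial k : ℝ) * R ^ k := by
        gcongr
        exact he k
    _ = _ := by ring

lemma summable_norm_mul_pow (z : ℝ) : Summable fun k => ‖e k * z ^ k‖ :=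
  Summable.of_nonneg_of_le (fun _ => norm_nonneg _) (norm_mul_pow_le he le_rfl)
    (Real.summable_pow_div_factorial |z|)

lemma continuous_tsum_mul_pow : Continuous fun z : ℝ => ∑' k, e k * z ^ k := by
  rw [continuous_iff_continuousAt]
  intro z
  have h : ContinuousOn (fun z : ℝ => ∑' k, e k * z ^ k) (Metric.closedBall 0 (|z| + 1)) := by
    refine continuousOn_tsum (fun i => by fun_prop)
      (Real.summable_pow_div_factorial (|z| + 1)) fun k y hy => norm_mul_pow_le he ?_ k
    simpa using hy
  refine h.continuousAt (Metric.closedBall_mem_nhds_of_mem ?_)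
  simp

end PowerSeries

lemma continuous_bes : Continuous bes := continuous_tsum_mul_pow abs_coeff_le

lemma continuous_bes0 : Continuous bes0 := continuous_tsum_mul_pow abs_coeff_zero_le

lemma bes_zero : bes 0 = 1 := by
  rw [bes, tsum_eq_single 0]
  · simp [coeff]
  · intro k hk
    simp [hk]

lemma bes0_zero : bes0 0 = 1 := by
  rw [bes0, tsum_eq_single 0]
  · simp
  · intro k hk
    simp [hk]

lemma J0_eq (x : ℝ) : J0 x = bes0 (x ^ 2 / 4) := by
  refine tsum_congr fun k => ?_
  rw [pow_mul, show (x / 2) ^ 2 = x ^ 2 / 4 by ring]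
  ring

lemma J1_eq (x : ℝ) : J1 x = x / 2 * bes (x ^ 2 / 4) := by
  rw [J1, bes, ← tsum_mul_left]
  refine tsum_congr fun k => ?_
  rw [pow_succ, pow_mul, show (x / 2) ^ 2 = x ^ 2 / 4 by ring, coeff]
  ring

lemma hasDerivAt_mul_bes (z : ℝ) : HasDerivAt (fun z => z * bes z) (bes0 z) z := by
  have key : HasDerivAt (fun y : ℝ => ∑' k : ℕ, coeff k * y ^ (k + 1))
      (∑' k : ℕ, (-1) ^ k / (Nat.factorial k : ℝ) ^ 2 * z ^ k) z := by
    refine hasDerivAt_tsum_of_isPreconnected (t := Metric.ball 0 (|z| + 1)) (y₀ := 0)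
      (g' := fun k y => (-1) ^ k / (Nat.factorial k : ℝ) ^ 2 * y ^ k)
      (Real.summable_pow_div_factorial (|z| + 1)) Metric.isOpen_ball
      (convex_ball _ _).isPreconnected (fun k y _ => ?_)
      (fun k y hy => norm_mul_pow_le abs_coeff_zero_le ?_ k) (by simp; positivity) (by simp)
      (by simp)
    · have h := ((hasDerivAt_id y).pow (k + 1)).const_mul (coeff k)
      refine h.congr_deriv ?_
      rw [coeff, Nat.factorial_succ]
      have := one_le_factorial k
      simp
      field_simp
    · have h : ‖y‖ < _ := mem_ball_zero_iff.1 hy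
      exact h.le
  refine key.congr_of_eventuallyEq (Eventually.of_forall fun y => ?_)
  simp only [bes, ← tsum_mul_left]
  exact tsum_congr fun k => by ring

/-! ### Positivity below the first zero of `J₀` -/

lemma bes0_pos {z : ℝ} (hz : 0 ≤ z) (hz' : z < c0 ^ 2 / 4) (hc : 0 ≤ c0) : 0 < bes0 z := by
  by_contra! hneg
  have hcont : ContinuousOn bes0 (Icc 0 z) := continuous_bes0.continuousOn
  obtain ⟨y, hy, hy0⟩ := intermediate_value_Icc' hz hcont
    (show (0 : ℝ) ∈ Icc (bes0 z) (bes0 0) from ⟨hneg, by rw [bes0_zero]; norm_num⟩)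
  have hypos : 0 < y := hy.1.lt_of_ne (by rintro rfl; rw [bes0_zero] at hy0; norm_num at hy0)
  have hle : c0 ≤ 2 * √y := by
    refine csInf_le ⟨0, fun x hx => hx.1.le⟩ ⟨by positivity, ?_⟩
    rw [J0_eq, mul_pow, Real.sq_sqrt hy.1, ← hy0]
    congr 1
    ring
  have h2 : c0 ^ 2 ≤ 4 * y := by
    have := pow_le_pow_left₀ hc hle 2
    rw [mul_pow, Real.sq_sqrt hy.1] at this
    linarith
  linarith [hy.2]

lemma c0_nonneg : 0 ≤ c0 := Real.sInf_nonneg fun _ hx => hx.1.le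

lemma strictMonoOn_mul_bes : StrictMonoOn (fun z => z * bes z) (Icc 0 (c0 ^ 2 / 4)) := by
  refine strictMonoOn_of_deriv_pos (convex_Icc _ _)
    (continuous_id.mul continuous_bes).continuousOn fun z hz => ?_
  rw [interior_Icc] at hz
  rw [(hasDerivAt_mul_bes z).deriv]
  exact bes0_pos hz.1.le hz.2 c0_nonneg

lemma bes_pos {z : ℝ} (hz : 0 ≤ z) (hz' : z ≤ c0 ^ 2 / 4) : 0 < bes z := by
  rcases hz.eq_or_lt with rfl | h
  · rw [bes_zero]; norm_num
  · have := strictMonoOn_mul_bes ⟨le_rfl, hz.trans hz'⟩ ⟨hz, hz'⟩ h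
    simp only [zero_mul] at this
    exact pos_of_mul_pos_right this hz

lemma Sfun_eq {y : ℝ} (hy : 0 ≤ y) : Sfun y = y * bes (π ^ 2 * y) := by
  rw [Sfun, J1_eq, show (2 * π * √y) ^ 2 / 4 = π ^ 2 * √y ^ 2 by ring, Real.sq_sqrt hy]
  have := Real.pi_pos
  field_simp
  rw [Real.sq_sqrt hy]

/-- The claimed closed form of the generating function, at every angle. -/
noncomputable def sol (c θ : ℝ) : ℝ := c * bes (c * θ ^ 2)

lemma continuous_sol (c : ℝ) : Continuous (sol c) :=
  continuous_const.mul (continuous_bes.comp (by fun_prop))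

lemma sol_zero (c : ℝ) : sol c 0 = c := by simp [sol, bes_zero]

lemma sol_pi {c : ℝ} (hc : 0 ≤ c) : sol c π = Sfun c := by
  rw [Sfun_eq hc, sol, mul_comm c (π ^ 2)]

lemma sol_eq_J1 {c θ : ℝ} (hc : 0 ≤ c) (hθ : θ ≠ 0) :
    √c / θ * J1 (2 * θ * √c) = sol c θ := by
  rw [J1_eq, show (2 * θ * √c) ^ 2 / 4 = θ ^ 2 * √c ^ 2 by ring, Real.sq_sqrt hc, sol,
    mul_comm c (θ ^ 2)]
  field_simp
  rw [Real.sq_sqrt hc]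

lemma pi_sq_mul_le {c : ℝ} (hc : c ≤ (c0 / (2 * π)) ^ 2) : π ^ 2 * c ≤ c0 ^ 2 / 4 := by
  have := Real.pi_pos
  calc π ^ 2 * c ≤ π ^ 2 * (c0 / (2 * π)) ^ 2 := by gcongr
    _ = _ := by field_simp; norm_num

lemma sol_nonneg {c θ : ℝ} (hc : 0 ≤ c) (hc' : c ≤ (c0 / (2 * π)) ^ 2) (hθ : θ ∈ Icc 0 π) :
    0 ≤ sol c θ := by
  refine mul_nonneg hc (bes_pos (by positivity) ((pi_sq_mul_le hc').trans' ?_)).le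
  rw [mul_comm]
  have := hθ.1
  gcongr
  exact hθ.2

lemma strictMonoOn_Sfun : StrictMonoOn Sfun (Icc 0 ((c0 / (2 * π)) ^ 2)) := by
  intro a ha b hb hab
  have := Real.pi_pos
  have h := strictMonoOn_mul_bes (a := π ^ 2 * a) (b := π ^ 2 * b)
    ⟨mul_nonneg (sq_nonneg _) ha.1, pi_sq_mul_le ha.2⟩
    ⟨mul_nonneg (sq_nonneg _) hb.1, pi_sq_mul_le hb.2⟩ (by gcongr)
  simp only [mul_assoc] at h
  rw [Sfun_eq ha.1, Sfun_eq hb.1]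
  exact lt_of_mul_lt_mul_left h (sq_nonneg _)

lemma exists_Sfun_eq {x : ℝ} (hx : 0 < x) (hx' : x ≤ xc) :
    ∃ c, 0 < c ∧ c ≤ (c0 / (2 * π)) ^ 2 ∧ Sfun c = x := by
  have hp := Real.pi_pos
  have hcont : ContinuousOn Sfun (Icc 0 ((c0 / (2 * π)) ^ 2)) := by
    refine ContinuousOn.congr (f := fun y => y * bes (π ^ 2 * y)) ?_ fun y hy => Sfun_eq hy.1
    exact (continuous_id.mul (continuous_bes.comp (by fun_prop))).continuousOn
  have h0 : Sfun 0 = 0 := by simp [Sfun]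
  have h1 : Sfun ((c0 / (2 * π)) ^ 2) = xc := by
    rw [Sfun, Real.sqrt_sq (div_nonneg c0_nonneg (by positivity)), xc,
      show 2 * π * (c0 / (2 * π)) = c0 by field_simp]
    field_simp
  obtain ⟨c, hc, rfl⟩ := intermediate_value_Icc (sq_nonneg _) hcont
    (show x ∈ Icc (Sfun 0) (Sfun ((c0 / (2 * π)) ^ 2)) by rw [h0, h1]; exact ⟨hx.le, hx'⟩)
  exact ⟨c, hc.1.lt_of_ne (by rintro rfl; exact hx.ne' h0), hc.2, rfl⟩

/-! ### The Volterra equation satisfied by the Bessel function -/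

lemma integral_pow_mul_sub_pow (θ : ℝ) (p q : ℕ) :
    ∫ α in (0 : ℝ)..θ, α ^ p * (θ - α) ^ q =
      (Nat.factorial p * Nat.factorial q : ℝ) / (Nat.factorial (p + q + 1) : ℝ) *
        θ ^ (p + q + 1) := by
  induction q generalizing p with
  | zero =>
    simp only [pow_zero, mul_one, integral_pow, add_zero, Nat.factorial_succ]
    have := one_le_factorial p
    push_cast
    simp
    field_simp
  | succ q ih =>
    have hu : ∀ α ∈ uIcc 0 θ, HasDerivAt (fun α : ℝ => (θ - α) ^ (q + 1))
        (-((q + 1) * (θ - α) ^ q)) α := fun α _ => by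
      refine (((hasDerivAt_id α).const_sub θ).pow (q + 1)).congr_deriv ?_
      simp
    have hv : ∀ α ∈ uIcc 0 θ, HasDerivAt (fun α : ℝ => α ^ (p + 1) / (p + 1)) (α ^ p) α :=
      fun α _ => by
        refine (((hasDerivAt_id α).pow (p + 1)).div_const ((p : ℝ) + 1)).congr_deriv ?_
        have : (p : ℝ) + 1 ≠ 0 := by positivity
        simp
        field_simp
    have key := intervalIntegral.integral_mul_deriv_eq_deriv_mul hu hv
      (Continuous.intervalIntegrable (by fun_prop) _ _)
      (Continuous.intervalIntegrable (by fun_prop) _ _)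
    have h2 : ∀ α : ℝ, -((q + 1) * (θ - α) ^ q) * (α ^ (p + 1) / (p + 1)) =
        -((q + 1) / (p + 1)) * (α ^ (p + 1) * (θ - α) ^ q) := fun α => by ring
    simp only [h2, intervalIntegral.integral_const_mul, ih] at key
    simp only [mul_comm (_ ^ p)]
    rw [key, show p + (q + 1) + 1 = p + 1 + q + 1 by ring, Nat.factorial_succ p,
      Nat.factorial_succ q]
    have := one_le_factorial (p + 1 + q + 1)
    push_cast
    field_simp
    simp

lemma hasSum_integral_of_bound {F : ℕ → ℝ → ℝ} {f : ℝ → ℝ} {u : ℕ → ℝ} {a b : ℝ}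
    (hab : a ≤ b) (hF : ∀ n, Continuous (F n)) (hu : Summable u)
    (hb : ∀ n, ∀ t ∈ Icc a b, |F n t| ≤ u n) (hf : ∀ t ∈ Icc a b, HasSum (fun n => F n t) (f t)) :
    HasSum (fun n => ∫ t in a..b, F n t) (∫ t in a..b, f t) := by
  have hI : ∀ t ∈ uIoc a b, t ∈ Icc a b := fun t ht => by
    rw [uIoc_of_le hab] at ht
    exact Ioc_subset_Icc_self ht
  refine intervalIntegral.hasSum_integral_of_dominated_convergence (fun n _ => u n)
    (fun n => (hF n).aestronglyMeasurable)
    (fun n => Eventually.of_forall fun t ht => hb n t (hI t ht))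
    (Eventually.of_forall fun t _ => hu) intervalIntegrable_const
    (Eventually.of_forall fun t ht => hf t (hI t ht))

/-- The double integral of `g α * h β` over the triangle `α, β ≥ 0`, `α + β ≤ θ`. -/
noncomputable def tri (g h : ℝ → ℝ) (θ : ℝ) : ℝ :=
  ∫ α in (0 : ℝ)..θ, g α * ∫ β in (0 : ℝ)..(θ - α), h β

lemma hasSum_sol (c θ : ℝ) :
    HasSum (fun k => c * coeff k * c ^ k * θ ^ (2 * k)) (sol c θ) := by
  have h := ((summable_norm_mul_pow abs_coeff_le (c * θ ^ 2)).of_norm.hasSum).mul_left c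
  refine h.congr_fun fun k => ?_
  rw [mul_pow, ← pow_mul]
  ring

lemma summable_abs_sol (c θ : ℝ) :
    Summable fun k => |c * coeff k * c ^ k * θ ^ (2 * k)| := by
  have h := (summable_norm_mul_pow abs_coeff_le (c * θ ^ 2)).mul_left |c|
  refine h.congr fun k => ?_
  rw [Real.norm_eq_abs, ← abs_mul, mul_pow, ← pow_mul]
  congr 1
  ring

lemma abs_mul_pow_le (a : ℝ) {t θ : ℝ} (ht : t ∈ Icc 0 θ) (n : ℕ) :
    |a * t ^ n| ≤ |a * θ ^ n| := by
  have h0 := ht.1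
  have h1 := ht.2
  rw [abs_mul, abs_mul, abs_of_nonneg (pow_nonneg h0 n),
    abs_of_nonneg (pow_nonneg (h0.trans h1) n)]
  gcongr

lemma hasSum_integral_sol (c : ℝ) {t : ℝ} (ht : 0 ≤ t) :
    HasSum (fun j => c * coeff j * c ^ j * (t ^ (2 * j + 1) / (2 * j + 1)))
      (∫ β in (0 : ℝ)..t, sol c β) := by
  have h := hasSum_integral_of_bound ht
    (F := fun j β => c * coeff j * c ^ j * β ^ (2 * j)) (fun n => by fun_prop)
    (summable_abs_sol c t) (fun n s hs => abs_mul_pow_le _ hs _) (fun s _ => hasSum_sol c s)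
  simpa [intervalIntegral.integral_const_mul, integral_pow] using h

lemma sum_antidiagonal_coeff (n : ℕ) :
    ∑ kj ∈ Finset.HasAntidiagonal.antidiagonal n, coeff kj.1 * coeff kj.2 *
      ((Nat.factorial (2 * kj.1) * Nat.factorial (2 * kj.2) : ℝ) /
        (Nat.factorial (2 * n + 2) : ℝ)) = -coeff (n + 1) := by
  have hc : ∀ k, coeff k * (Nat.factorial (2 * k) : ℝ) = (-1) ^ k * (catalan k : ℝ) := by
    intro k
    have h1 : ((k : ℝ) + 1) * catalan k = Nat.centralBinom k := by
      exact_mod_cast succ_mul_catalan_eq_centralBinom k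
    have h2 : (Nat.centralBinom k : ℝ) * (Nat.factorial k * Nat.factorial k) =
        Nat.factorial (2 * k) := by
      have := Nat.choose_mul_factorial_mul_factorial (show k ≤ 2 * k by omega)
      rw [show 2 * k - k = k by omega, ← Nat.centralBinom_eq_two_mul_choose] at this
      rw [← mul_assoc]
      exact_mod_cast this
    have := one_le_factorial k
    rw [coeff, ← h2, ← h1, Nat.factorial_succ]
    push_cast
    field_simp
  have hF := one_le_factorial (2 * n + 2)
  have h3 : ∀ kj ∈ Finset.HasAntidiagonal.antidiagonal n, coeff kj.1 * coeff kj.2 *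
      ((Nat.factorial (2 * kj.1) * Nat.factorial (2 * kj.2) : ℝ) /
        (Nat.factorial (2 * n + 2) : ℝ)) =
      (-1) ^ n / (Nat.factorial (2 * n + 2) : ℝ) * ((catalan kj.1 * catalan kj.2 : ℕ) : ℝ) := by
    intro kj hkj
    rw [← Finset.HasAntidiagonal.mem_antidiagonal.1 hkj, pow_add, Nat.cast_mul]
    linear_combination (coeff kj.2 * (Nat.factorial (2 * kj.2) : ℝ)) /
        (Nat.factorial (2 * (kj.1 + kj.2) + 2) : ℝ) * hc kj.1 +
      (-1) ^ kj.1 * (catalan kj.1 : ℝ) / (Nat.factorial (2 * (kj.1 + kj.2) + 2) : ℝ) * hc kj.2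
  rw [Finset.sum_congr rfl h3, ← Finset.mul_sum, ← Nat.cast_sum, ← catalan_succ']
  have h4 := hc (n + 1)
  rw [show 2 * (n + 1) = 2 * n + 2 by ring, pow_succ] at h4
  rw [div_mul_eq_mul_div, div_eq_iff (by positivity)]
  linarith

lemma sol_volterra (c : ℝ) {θ : ℝ} (hθ : 0 ≤ θ) : sol c θ = c - tri (sol c) (sol c) θ := by
  set A : ℕ → ℝ := fun k => c * coeff k * c ^ k with hA
  let f : ℝ → ℕ → ℝ := fun α k => A k * α ^ (2 * k)
  let p : ℝ → ℕ → ℝ := fun t j => A j * (t ^ (2 * j + 1) / (2 * j + 1))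
  have hf : ∀ α, Summable fun k => ‖f α k‖ := summable_abs_sol c
  have hp : ∀ t, Summable fun j => ‖p t j‖ := by
    intro t
    refine Summable.of_nonneg_of_le (fun _ => norm_nonneg _) (fun j => ?_) ((hf t).mul_left |t|)
    have : p t j = t * f t j * (1 / (2 * j + 1)) := by simp only [p, f]; ring
    rw [this, norm_mul, norm_mul, Real.norm_eq_abs t]
    refine mul_le_of_le_one_right (by positivity) ?_
    rw [Real.norm_of_nonneg (by positivity)]
    exact (div_le_one (by positivity)).2 (by linarith [(Nat.cast_nonneg j : (0 : ℝ) ≤ j)])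
  have hsum := hasSum_integral_of_bound hθ
    (F := fun n α => ∑ kj ∈ Finset.HasAntidiagonal.antidiagonal n, f α kj.1 * p (θ - α) kj.2)
    (f := fun α => sol c α * ∫ β in (0 : ℝ)..(θ - α), sol c β)
    (u := fun n => ∑ kj ∈ Finset.HasAntidiagonal.antidiagonal n, |f θ kj.1| * |p θ kj.2|)
    (fun n => by fun_prop) ?_ ?_ ?_
  rotate_left
  · have := summable_norm_sum_mul_antidiagonal_of_summable_norm (hf θ).norm (hp θ).norm
    exact this.of_norm
  · intro n t ht
    refine (Finset.abs_sum_le_sum_abs _ _).trans (Finset.sum_le_sum fun kj _ => ?_)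
    rw [abs_mul]
    have h1 := abs_mul_pow_le (A kj.1) ht (2 * kj.1)
    have h2 := abs_mul_pow_le (A kj.2 / (2 * kj.2 + 1))
      (t := θ - t) (θ := θ) ⟨by linarith [ht.2], by linarith [ht.1]⟩ (2 * kj.2 + 1)
    have h3 : ∀ s, p s kj.2 = A kj.2 / (2 * kj.2 + 1) * s ^ (2 * kj.2 + 1) := fun s => by
      simp only [p]; ring
    rw [h3, h3]
    gcongr
  · intro t ht
    have h1 := (hasSum_sol c t).tsum_eq
    have h2 := (hasSum_integral_sol c (sub_nonneg.2 ht.2)).tsum_eq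
    rw [← h1, ← h2]
    rw [show (∑' k, c * coeff k * c ^ k * t ^ (2 * k)) = ∑' k, f t k from rfl,
      show (∑' j : ℕ, c * coeff j * c ^ j * ((θ - t) ^ (2 * j + 1) / (2 * j + 1))) =
        ∑' j, p (θ - t) j from rfl,
      tsum_mul_tsum_eq_tsum_sum_antidiagonal_of_summable_norm (hf t) (hp (θ - t))]
    exact (summable_norm_sum_mul_antidiagonal_of_summable_norm (hf t) (hp (θ - t))).of_norm.hasSum
  have hterm : ∀ n, ∫ α in (0 : ℝ)..θ,
      ∑ kj ∈ Finset.HasAntidiagonal.antidiagonal n, f α kj.1 * p (θ - α) kj.2 =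
        -(A (n + 1) * θ ^ (2 * (n + 1))) := by
    intro n
    rw [intervalIntegral.integral_finsetSum fun kj _ =>
      Continuous.intervalIntegrable (by fun_prop) _ _]
    have h1 : ∀ kj ∈ Finset.HasAntidiagonal.antidiagonal n, ∫ α in (0 : ℝ)..θ, f α kj.1 * p (θ - α) kj.2 =
        c ^ (n + 2) * θ ^ (2 * (n + 1)) * (coeff kj.1 * coeff kj.2 *
          ((Nat.factorial (2 * kj.1) * Nat.factorial (2 * kj.2) : ℝ) /
            (Nat.factorial (2 * n + 2) : ℝ))) := by
      intro kj hkj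
      have h2 : ∀ α, f α kj.1 * p (θ - α) kj.2 = A kj.1 * A kj.2 / (2 * kj.2 + 1) *
          (α ^ (2 * kj.1) * (θ - α) ^ (2 * kj.2 + 1)) := fun α => by simp only [f, p]; ring
      simp only [h2, intervalIntegral.integral_const_mul, integral_pow_mul_sub_pow]
      obtain rfl := Finset.HasAntidiagonal.mem_antidiagonal.1 hkj
      rw [show 2 * kj.1 + (2 * kj.2 + 1) + 1 = 2 * (kj.1 + kj.2) + 2 by ring,
        Nat.factorial_succ (2 * kj.2), hA]
      have hF := one_le_factorial (2 * (kj.1 + kj.2) + 2)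
      push_cast
      field_simp
      ring
    rw [Finset.sum_congr rfl h1, ← Finset.mul_sum, sum_antidiagonal_coeff, hA]
    ring
  simp only [hterm] at hsum
  have h0 := (hasSum_nat_add_iff' 1).2 (hasSum_sol c θ)
  have h1 : -tri (sol c) (sol c) θ = sol c θ - ∑ i ∈ Finset.range 1, f θ i :=
    (hsum.neg.congr_fun fun k => by rw [neg_neg]).unique h0
  have h2 : f θ 0 = c := by simp [f, A, coeff]
  rw [Finset.sum_range_one, h2] at h1
  linarith

/-! ### The integral operator attached to a node -/

/-- The integral of `g α * h β` over the region `θ < α + β < π`, `α, β ≥ 0`. -/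
noncomputable def strip (g h : ℝ → ℝ) (θ : ℝ) : ℝ :=
  ∫ α in (0 : ℝ)..π, g α * ∫ β in (max 0 (min θ π - α))..(π - α), h β

lemma integral_ite_eq_strip (g h : ℝ → ℝ) (θ : ℝ) :
    (∫ α in (0 : ℝ)..π, ∫ β in (0 : ℝ)..π,
      if θ < α + β ∧ α + β < π then g α * h β else 0) = strip g h θ := by
  refine intervalIntegral.integral_congr fun α hα => ?_
  rw [uIcc_of_le Real.pi_pos.le] at hα
  have hab : max 0 (min θ π - α) ≤ π - α :=
    max_le (by linarith [hα.2]) (by linarith [min_le_right θ π])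
  have h0 : 0 ≤ max 0 (min θ π - α) := le_max_left _ _
  rw [← intervalIntegral.integral_const_mul, intervalIntegral.integral_of_le Real.pi_pos.le,
    intervalIntegral.integral_of_le hab, integral_Ioc_eq_integral_Ioo (x := max 0 (min θ π - α)),
    ← integral_indicator measurableSet_Ioc, ← integral_indicator measurableSet_Ioo]
  congr 1
  funext β
  simp only [indicator, mem_Ioc, mem_Ioo, max_lt_iff, sub_lt_iff_lt_add, min_lt_iff]
  have hα0 := hα.1
  split_ifs <;> first | rfl | grind

lemma continuous_primitive {h : ℝ → ℝ} (hh : ∀ a b, IntervalIntegrable h volume a b) :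
    Continuous fun t => ∫ β in (0 : ℝ)..t, h β :=
  intervalIntegral.continuous_primitive hh 0

lemma integral_eq_primitive_sub {h : ℝ → ℝ} (hh : Continuous h) (a b : ℝ) :
    ∫ β in a..b, h β = (∫ β in (0 : ℝ)..b, h β) - ∫ β in (0 : ℝ)..a, h β :=
  (intervalIntegral.integral_interval_sub_left (hh.intervalIntegrable _ _)
    (hh.intervalIntegrable _ _)).symm

lemma continuous_strip_integrand {h : ℝ → ℝ} (hh : Continuous h) :
    Continuous fun p : ℝ × ℝ => ∫ β in (max 0 (min p.1 π - p.2))..(π - p.2), h β := by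
  have := continuous_primitive fun a b => hh.intervalIntegrable (μ := volume) a b
  simp only [integral_eq_primitive_sub hh (max _ _)]
  exact (this.comp (by fun_prop)).sub (this.comp (by fun_prop))

lemma continuous_strip_integrand' {h : ℝ → ℝ} (hh : Continuous h) (θ : ℝ) :
    Continuous fun α : ℝ => ∫ β in (max 0 (min θ π - α))..(π - α), h β :=
  (continuous_strip_integrand hh).comp (by fun_prop : Continuous fun α : ℝ => (θ, α))

lemma continuous_strip {g h : ℝ → ℝ} (hg : Continuous g) (hh : Continuous h) :
    Continuous (strip g h) := by
  refine intervalIntegral.continuous_parametric_intervalIntegral_of_continuous'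
    (f := fun θ α => g α * ∫ β in (max 0 (min θ π - α))..(π - α), h β) ?_ 0 π
  exact (hg.comp continuous_snd).mul (continuous_strip_integrand hh)

lemma strip_clamp (g h : ℝ → ℝ) (θ : ℝ) : strip g h (max 0 (min θ π)) = strip g h θ := by
  refine intervalIntegral.integral_congr fun α hα => ?_
  rw [uIcc_of_le Real.pi_pos.le] at hα
  have := Real.pi_pos
  have hα0 := hα.1
  have : max 0 (min (max 0 (min θ π)) π - α) = max 0 (min θ π - α) := by
    grind
  simp only [this]

lemma strip_eq_tri {g h : ℝ → ℝ} (hg : Continuous g) (hh : Continuous h) {θ : ℝ}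
    (hθ : θ ∈ Icc 0 π) : strip g h θ = tri g h π - tri g h θ := by
  have hH := continuous_primitive fun a b => hh.intervalIntegrable (μ := volume) a b
  have h1 : strip g h θ = tri g h π -
      ∫ α in (0 : ℝ)..π, g α * ∫ β in (0 : ℝ)..max 0 (θ - α), h β := by
    rw [strip, tri, ← intervalIntegral.integral_sub]
    · refine intervalIntegral.integral_congr fun α _ => ?_
      rw [integral_eq_primitive_sub hh (max _ _), min_eq_left hθ.2]
      ring
    · exact (hg.mul (hH.comp (by fun_prop : Continuous fun α => π - α))).intervalIntegrable _ _
    · exact (hg.mul (hH.comp (by fun_prop : Continuous fun α => max 0 (θ - α)))).intervalIntegrable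
        _ _
  have hint : ∀ a b, IntervalIntegrable
      (fun α => g α * ∫ β in (0 : ℝ)..max 0 (θ - α), h β) volume a b := fun a b =>
    (hg.mul (hH.comp (by fun_prop : Continuous fun α => max 0 (θ - α)))).intervalIntegrable _ _
  rw [h1, ← intervalIntegral.integral_add_adjacent_intervals (hint 0 θ) (hint θ π)]
  have h2 : ∫ α in θ..π, g α * ∫ β in (0 : ℝ)..max 0 (θ - α), h β = 0 := by
    rw [intervalIntegral.integral_congr (g := fun _ => 0), intervalIntegral.integral_zero]
    intro α hα
    rw [uIcc_of_le hθ.2] at hα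
    simp [max_eq_left (sub_nonpos.2 hα.1)]
  have h3 : ∫ α in (0 : ℝ)..θ, g α * ∫ β in (0 : ℝ)..max 0 (θ - α), h β = tri g h θ := by
    refine intervalIntegral.integral_congr fun α hα => ?_
    rw [uIcc_of_le hθ.1] at hα
    simp only [max_eq_right (sub_nonneg.2 hα.2)]
  rw [h2, h3, add_zero]

lemma strip_mono {g₁ g₂ h₁ h₂ : ℝ → ℝ} (hg₁ : Continuous g₁) (hg₂ : Continuous g₂)
    (hh₁ : Continuous h₁) (hh₂ : Continuous h₂) (hg : ∀ α ∈ Icc 0 π, 0 ≤ g₁ α ∧ g₁ α ≤ g₂ α)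
    (hh : ∀ α ∈ Icc 0 π, 0 ≤ h₁ α ∧ h₁ α ≤ h₂ α) (θ : ℝ) :
    0 ≤ strip g₁ h₁ θ ∧ strip g₁ h₁ θ ≤ strip g₂ h₂ θ := by
  have key : ∀ α ∈ Icc 0 π, 0 ≤ ∫ β in (max 0 (min θ π - α))..(π - α), h₁ β ∧
      ∫ β in (max 0 (min θ π - α))..(π - α), h₁ β ≤
        ∫ β in (max 0 (min θ π - α))..(π - α), h₂ β := by
    intro α hα
    have hab : max 0 (min θ π - α) ≤ π - α :=
      max_le (by linarith [hα.2]) (by linarith [min_le_right θ π])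
    have hsub : ∀ β ∈ Icc (max 0 (min θ π - α)) (π - α), β ∈ Icc 0 π := fun β hβ =>
      ⟨(le_max_left _ _).trans hβ.1, by linarith [hβ.2, hα.1]⟩
    exact ⟨intervalIntegral.integral_nonneg hab fun β hβ => (hh β (hsub β hβ)).1,
      intervalIntegral.integral_mono_on hab (hh₁.intervalIntegrable _ _)
        (hh₂.intervalIntegrable _ _) fun β hβ => (hh β (hsub β hβ)).2⟩
  constructor
  · exact intervalIntegral.integral_nonneg Real.pi_pos.le fun α hα =>
      mul_nonneg (hg α hα).1 (key α hα).1
  · refine intervalIntegral.integral_mono_on Real.pi_pos.le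
      ((hg₁.mul (continuous_strip_integrand' hh₁ θ)).intervalIntegrable _ _)
      ((hg₂.mul (continuous_strip_integrand' hh₂ θ)).intervalIntegrable _ _) fun α hα => ?_
    exact mul_le_mul (hg α hα).2 (key α hα).2 (key α hα).1 ((hg α hα).1.trans (hg α hα).2)

lemma strip_sum {ι : Type*} (s : Finset ι) {g : ι → ℝ → ℝ} (hg : ∀ i, Continuous (g i))
    (a : ι → ℝ) (θ : ℝ) :
    strip (fun α => ∑ i ∈ s, g i α * a i) (fun α => ∑ i ∈ s, g i α * a i) θ =
      ∑ i ∈ s, ∑ j ∈ s, strip (g i) (g j) θ * (a i * a j) := by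
  have h1 : ∀ u v : ℝ, ∫ β in u..v, ∑ i ∈ s, g i β * a i = ∑ i ∈ s, (∫ β in u..v, g i β) * a i := by
    intro u v
    rw [intervalIntegral.integral_finsetSum fun i _ =>
      Continuous.intervalIntegrable (by have := hg i; fun_prop) _ _]
    simp only [intervalIntegral.integral_mul_const]
  simp only [strip, h1, Finset.sum_mul_sum]
  have hc : ∀ i j, Continuous fun α : ℝ => g i α * a i *
      ((∫ β in (max 0 (min θ π - α))..(π - α), g j β) * a j) := fun i j =>
    ((hg i).mul continuous_const).mul ((continuous_strip_integrand' (hg j) θ).mul continuous_const)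
  rw [intervalIntegral.integral_finsetSum fun i _ =>
    (continuous_finsetSum _ fun j _ => hc i j).intervalIntegrable _ _]
  refine Finset.sum_congr rfl fun i _ => ?_
  rw [intervalIntegral.integral_finsetSum fun j _ => (hc i j).intervalIntegrable _ _]
  refine Finset.sum_congr rfl fun j _ => ?_
  rw [← intervalIntegral.integral_mul_const]
  refine intervalIntegral.integral_congr fun α _ => ?_
  ring

/-! ### Tree weights -/

lemma mAngle_node (l r : BinTree) : mAngle (.node l r) = strip (mAngle l) (mAngle r) := by
  funext θ
  exact integral_ite_eq_strip _ _ θ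

lemma continuous_mAngle (τ : BinTree) : Continuous (mAngle τ) := by
  induction τ with
  | leaf => exact continuous_const
  | node l r hl hr =>
    rw [mAngle_node]
    exact continuous_strip hl hr

lemma mAngle_nonneg (τ : BinTree) (θ : ℝ) : 0 ≤ mAngle τ θ := by
  induction τ generalizing θ with
  | leaf => exact zero_le_one
  | node l r hl hr =>
    rw [mAngle_node]
    exact (strip_mono (continuous_mAngle l) (continuous_mAngle l) (continuous_mAngle r)
      (continuous_mAngle r) (fun α _ => ⟨hl α, le_rfl⟩) (fun α _ => ⟨hr α, le_rfl⟩) θ).1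

lemma mAngle_clamp (τ : BinTree) (θ : ℝ) : mAngle τ (max 0 (min θ π)) = mAngle τ θ := by
  cases τ with
  | leaf => rfl
  | node l r => rw [mAngle_node, strip_clamp]

lemma leaves_pos (τ : BinTree) : 0 < τ.leaves := by
  induction τ with
  | leaf => exact Nat.one_pos
  | node l r hl hr => exact Nat.add_pos_left hl _

open Classical in
/-- The binary trees of height less than `n`. -/
noncomputable def trees : ℕ → Finset BinTree
  | 0 => ∅
  | n + 1 => insert .leaf ((trees n ×ˢ trees n).image fun p => .node p.1 p.2)

lemma mem_trees_succ {n : ℕ} {τ : BinTree} :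
    τ ∈ trees (n + 1) ↔ τ = .leaf ∨ ∃ l ∈ trees n, ∃ r ∈ trees n, .node l r = τ := by
  simp only [trees, Finset.mem_insert, Finset.mem_image, Finset.mem_product, Prod.exists]
  grind

lemma trees_subset_succ (n : ℕ) : trees n ⊆ trees (n + 1) := by
  induction n with
  | zero => simp [trees]
  | succ n ih =>
    intro τ hτ
    rw [mem_trees_succ] at hτ ⊢
    rcases hτ with h | ⟨l, hl, r, hr, h⟩
    · exact Or.inl h
    · exact Or.inr ⟨l, ih hl, r, ih hr, h⟩

lemma monotone_trees : Monotone trees := monotone_nat_of_le_succ trees_subset_succ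

lemma exists_mem_trees (τ : BinTree) : ∃ n, τ ∈ trees n := by
  induction τ with
  | leaf => exact ⟨1, mem_trees_succ.2 (Or.inl rfl)⟩
  | node l r hl hr =>
    obtain ⟨m, hm⟩ := hl
    obtain ⟨n, hn⟩ := hr
    exact ⟨max m n + 1, mem_trees_succ.2 (Or.inr ⟨l, monotone_trees (le_max_left m n) hm, r,
      monotone_trees (le_max_right m n) hn, rfl⟩)⟩

lemma tendsto_trees : Tendsto trees atTop atTop :=
  tendsto_atTop_finset_of_monotone monotone_trees exists_mem_trees

/-- Partial generating function over the trees of height less than `n`. -/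
noncomputable def approx (x : ℝ) (n : ℕ) (θ : ℝ) : ℝ :=
  ∑ τ ∈ trees n, mAngle τ θ * x ^ τ.leaves

lemma continuous_approx (x : ℝ) (n : ℕ) : Continuous (approx x n) :=
  continuous_finsetSum _ fun τ _ => (continuous_mAngle τ).mul continuous_const

lemma approx_succ (x : ℝ) (n : ℕ) (θ : ℝ) :
    approx x (n + 1) θ = x + strip (approx x n) (approx x n) θ := by
  classical
  have h := strip_sum (trees n) continuous_mAngle (fun τ => x ^ τ.leaves) θ
  rw [show strip (approx x n) (approx x n) θ = _ from h, approx, trees, Finset.sum_insert,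
    Finset.sum_image, Finset.sum_product]
  · simp [mAngle_node, BinTree.leaves, pow_add, show mAngle .leaf θ = 1 from rfl]
  · intro p _ q _ hpq
    simp only [BinTree.node.injEq] at hpq
    exact Prod.ext hpq.1 hpq.2
  · simp

lemma approx_nonneg {x : ℝ} (hx : 0 ≤ x) (n : ℕ) (θ : ℝ) : 0 ≤ approx x n θ :=
  Finset.sum_nonneg fun τ _ => mul_nonneg (mAngle_nonneg τ θ) (pow_nonneg hx _)

/-! ### Uniqueness for the Volterra equation -/

section Uniqueness

variable {g₁ g₂ : ℝ → ℝ} {c M : ℝ}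
  (h₁ : ∀ a b, IntervalIntegrable g₁ volume a b) (h₂ : ∀ a b, IntervalIntegrable g₂ volume a b)
  (b₁ : ∀ θ ∈ Icc 0 π, |g₁ θ| ≤ M) (b₂ : ∀ θ ∈ Icc 0 π, |g₂ θ| ≤ M)
include h₁ h₂ b₁ b₂

lemma abs_tri_sub_tri_le {θ : ℝ} (hθ : θ ∈ Icc 0 π) :
    |tri g₁ g₁ θ - tri g₂ g₂ θ| ≤ 2 * M * π * ∫ t in (0 : ℝ)..θ, |g₁ t - g₂ t| := by
  have hM : 0 ≤ M := (abs_nonneg _).trans (b₁ θ hθ)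
  have hd : ∀ a b, IntervalIntegrable (fun t => |g₁ t - g₂ t|) volume a b := fun a b =>
    ((h₁ a b).sub (h₂ a b)).abs
  set E := ∫ t in (0 : ℝ)..θ, |g₁ t - g₂ t| with hE
  have hE0 : 0 ≤ E := intervalIntegral.integral_nonneg hθ.1 fun _ _ => abs_nonneg _
  have hprod : ∀ g : ℝ → ℝ, (∀ a b, IntervalIntegrable g volume a b) →
      IntervalIntegrable (fun α => g α * ∫ β in (0 : ℝ)..(θ - α), g β) volume 0 θ := fun g hg =>
    (hg 0 θ).mul_continuousOn
      ((continuous_primitive hg).comp (by fun_prop : Continuous fun α => θ - α)).continuousOn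
  rw [tri, tri, ← intervalIntegral.integral_sub (hprod g₁ h₁) (hprod g₂ h₂)]
  have hbound : ∀ α ∈ Ioc 0 θ, ‖(g₁ α * ∫ β in (0 : ℝ)..(θ - α), g₁ β) -
      g₂ α * ∫ β in (0 : ℝ)..(θ - α), g₂ β‖ ≤ M * π * |g₁ α - g₂ α| + M * E := by
    intro α hα
    have hs0 : 0 ≤ θ - α := sub_nonneg.2 hα.2
    have hsθ : θ - α ≤ θ := by linarith [hα.1]
    have hH1 : |∫ β in (0 : ℝ)..(θ - α), g₁ β| ≤ M * π := by
      have h := intervalIntegral.norm_integral_le_of_norm_le_const (a := 0) (b := θ - α)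
        (f := g₁) (C := M) fun t ht => by
          rw [uIoc_of_le hs0] at ht
          exact b₁ t ⟨ht.1.le, by linarith [ht.2, hθ.2]⟩
      refine h.trans ?_
      rw [sub_zero, abs_of_nonneg hs0]
      gcongr
      linarith [hθ.2]
    have hH2 : |(∫ β in (0 : ℝ)..(θ - α), g₁ β) - ∫ β in (0 : ℝ)..(θ - α), g₂ β| ≤ E := by
      rw [← intervalIntegral.integral_sub (h₁ _ _) (h₂ _ _)]
      refine (intervalIntegral.abs_integral_le_integral_abs hs0).trans ?_
      exact intervalIntegral.integral_mono_interval le_rfl hs0 hsθ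
        (Eventually.of_forall fun _ => abs_nonneg _) (hd _ _)
    have hg2 := b₂ α ⟨hα.1.le, hα.2.trans hθ.2⟩
    generalize (∫ β in (0 : ℝ)..(θ - α), g₁ β) = H1 at *
    generalize (∫ β in (0 : ℝ)..(θ - α), g₂ β) = H2 at *
    rw [Real.norm_eq_abs, show g₁ α * H1 - g₂ α * H2 =
      H1 * (g₁ α - g₂ α) + g₂ α * (H1 - H2) by ring]
    refine (abs_add_le _ _).trans ?_
    rw [abs_mul, abs_mul]
    gcongr
  have h := intervalIntegral.norm_integral_le_of_norm_le hθ.1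
    (Eventually.of_forall (p := fun α => α ∈ Ioc 0 θ → _) hbound)
    (((hd 0 θ).const_mul _).add intervalIntegrable_const)
  rw [Real.norm_eq_abs] at h
  refine h.trans ?_
  rw [intervalIntegral.integral_add ((hd 0 θ).const_mul _) intervalIntegrable_const,
    intervalIntegral.integral_const_mul, intervalIntegral.integral_const, ← hE, smul_eq_mul,
    sub_zero]
  nlinarith [mul_le_mul_of_nonneg_right hθ.2 (mul_nonneg hM hE0)]

lemma volterra_unique (e₁ : ∀ θ ∈ Icc 0 π, g₁ θ = c - tri g₁ g₁ θ)
    (e₂ : ∀ θ ∈ Icc 0 π, g₂ θ = c - tri g₂ g₂ θ) {θ : ℝ} (hθ : θ ∈ Icc 0 π) : g₁ θ = g₂ θ := by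
  have hM : 0 ≤ M := (abs_nonneg _).trans (b₁ θ hθ)
  have hpi := Real.pi_pos
  have hd : ∀ a b, IntervalIntegrable (fun t => |g₁ t - g₂ t|) volume a b := fun a b =>
    ((h₁ a b).sub (h₂ a b)).abs
  have step : ∀ θ ∈ Icc 0 π,
      |g₁ θ - g₂ θ| ≤ 2 * M * π * ∫ t in (0 : ℝ)..θ, |g₁ t - g₂ t| := fun θ hθ => by
    refine (abs_tri_sub_tri_le h₁ h₂ b₁ b₂ hθ).trans' (le_of_eq ?_)
    rw [e₁ θ hθ, e₂ θ hθ, abs_sub_comm]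
    congr 1
    ring
  have iter : ∀ n : ℕ, ∀ θ ∈ Icc 0 π,
      |g₁ θ - g₂ θ| ≤ 2 * M * ((2 * M * π * θ) ^ n / (Nat.factorial n : ℝ)) := by
    intro n
    induction n with
    | zero =>
      intro θ hθ
      have := abs_sub (g₁ θ) (g₂ θ)
      simp
      linarith [b₁ θ hθ, b₂ θ hθ]
    | succ n ih =>
      intro θ hθ
      have h := intervalIntegral.integral_mono_on hθ.1 (hd 0 θ)
        (g := fun t => 2 * M * ((2 * M * π * t) ^ n / (Nat.factorial n : ℝ)))
        (Continuous.intervalIntegrable (by fun_prop) _ _)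
        fun t ht => ih t ⟨ht.1, ht.2.trans hθ.2⟩
      refine (step θ hθ).trans ((mul_le_mul_of_nonneg_left h (by positivity)).trans (le_of_eq ?_))
      simp only [mul_pow _ _ n, intervalIntegral.integral_const_mul,
        intervalIntegral.integral_div, integral_pow, Nat.factorial_succ]
      have := one_le_factorial n
      push_cast
      simp
      field_simp
      ring
  have hlim := (FloorSemiring.tendsto_pow_div_factorial_atTop (2 * M * π * θ)).const_mul (2 * M)
  rw [mul_zero] at hlim
  have h0 : |g₁ θ - g₂ θ| ≤ 0 := ge_of_tendsto' hlim fun n => iter n θ hθ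
  exact sub_eq_zero.1 (abs_nonpos_iff.1 h0)

end Uniqueness

lemma tendsto_tri {g : ℕ → ℝ → ℝ} {F : ℝ → ℝ} {M : ℝ} (hg : ∀ n, Continuous (g n))
    (hM : ∀ n t, |g n t| ≤ M) (hF : ∀ t, Tendsto (fun n => g n t) atTop (𝓝 (F t))) (θ : ℝ) :
    Tendsto (fun n => tri (g n) (g n) θ) atTop (𝓝 (tri F F θ)) := by
  have hM0 : 0 ≤ M := (abs_nonneg _).trans (hM 0 0)
  have hinner : ∀ s, Tendsto (fun n => ∫ β in (0 : ℝ)..s, g n β) atTop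
      (𝓝 (∫ β in (0 : ℝ)..s, F β)) := fun s =>
    intervalIntegral.tendsto_integral_filter_of_dominated_convergence (fun _ => M)
      (Eventually.of_forall fun n => (hg n).aestronglyMeasurable)
      (Eventually.of_forall fun n => Eventually.of_forall fun t _ => hM n t)
      intervalIntegrable_const (Eventually.of_forall fun t _ => hF t)
  refine intervalIntegral.tendsto_integral_filter_of_dominated_convergence
    (fun α => M * (M * |θ - α|)) (Eventually.of_forall fun n => ?_)
    (Eventually.of_forall fun n => Eventually.of_forall fun t _ => ?_)
    (Continuous.intervalIntegrable (by fun_prop) _ _)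
    (Eventually.of_forall fun t _ => (hF t).mul (hinner _))
  · have := continuous_primitive fun a b => (hg n).intervalIntegrable (μ := volume) a b
    exact ((hg n).mul (this.comp (by fun_prop : Continuous fun α => θ - α))).aestronglyMeasurable
  · rw [norm_mul]
    have h := intervalIntegral.norm_integral_le_of_norm_le_const (a := 0) (b := θ - t)
      (f := g n) (C := M) fun s _ => hM n s
    rw [sub_zero] at h
    exact mul_le_mul (hM n t) h (norm_nonneg _) hM0

/-! ### The generating function -/

lemma Sfun_pos {c : ℝ} (hc : 0 < c) (hc' : c ≤ (c0 / (2 * π)) ^ 2) : 0 < Sfun c := by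
  rw [Sfun_eq hc.le]
  exact mul_pos hc (bes_pos (by positivity) (pi_sq_mul_le hc'))

lemma sol_eq_strip {c θ : ℝ} (hc : 0 ≤ c) (hθ : θ ∈ Icc 0 π) :
    sol c θ = Sfun c + strip (sol c) (sol c) θ := by
  rw [strip_eq_tri (continuous_sol c) (continuous_sol c) hθ, ← sol_pi hc,
    sol_volterra c hθ.1, sol_volterra c Real.pi_pos.le]
  ring

lemma approx_le_sol {c : ℝ} (hc : 0 < c) (hc' : c ≤ (c0 / (2 * π)) ^ 2) (n : ℕ) :
    ∀ θ ∈ Icc 0 π, approx (Sfun c) n θ ≤ sol c θ := by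
  have hx := (Sfun_pos hc hc').le
  induction n with
  | zero =>
    intro θ hθ
    simpa [approx, trees] using sol_nonneg hc.le hc' hθ
  | succ n ih =>
    intro θ hθ
    rw [approx_succ, sol_eq_strip hc.le hθ]
    have h := fun α hα => And.intro (approx_nonneg hx n α) (ih α hα)
    have hcont := continuous_approx (Sfun c) n
    gcongr
    exact (strip_mono hcont (continuous_sol c) hcont (continuous_sol c) h h θ).2

lemma clamp_mem (θ : ℝ) : max 0 (min θ π) ∈ Icc 0 π :=
  ⟨le_max_left _ _, max_le Real.pi_pos.le (min_le_right _ _)⟩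

lemma approx_clamp (x : ℝ) (n : ℕ) (θ : ℝ) : approx x n (max 0 (min θ π)) = approx x n θ := by
  simp only [approx, mAngle_clamp]

/-- The generating function of all binary trees, weighted by angle volumes. -/
noncomputable def genFun (x θ : ℝ) : ℝ := ∑' τ, mAngle τ θ * x ^ τ.leaves

lemma summable_mAngle {x M : ℝ} (hx : 0 ≤ x) {θ : ℝ} (hM : ∀ n, approx x n θ ≤ M) :
    Summable fun τ => mAngle τ θ * x ^ τ.leaves := by
  have h0 : ∀ τ, 0 ≤ mAngle τ θ * x ^ τ.leaves := fun τ =>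
    mul_nonneg (mAngle_nonneg τ θ) (pow_nonneg hx _)
  refine summable_of_sum_le h0 (c := M) fun s => ?_
  obtain ⟨n, hn⟩ := (tendsto_trees.eventually_ge_atTop s).exists
  exact (Finset.sum_le_sum_of_subset_of_nonneg hn fun τ _ _ => h0 τ).trans (hM n)

theorem hasSum_mAngle {c : ℝ} (hc : 0 < c) (hc' : c ≤ (c0 / (2 * π)) ^ 2) {θ : ℝ}
    (hθ : θ ∈ Icc 0 π) : HasSum (fun τ => mAngle τ θ * Sfun c ^ τ.leaves) (sol c θ) := by
  set x := Sfun c with hxdef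
  have hpi := Real.pi_pos
  have hx : 0 < x := Sfun_pos hc hc'
  have hle : ∀ n t, approx x n t ≤ sol c (max 0 (min t π)) := fun n t => by
    rw [← approx_clamp]
    exact approx_le_sol hc hc' n _ (clamp_mem t)
  have hsum : ∀ t, HasSum (fun τ => mAngle τ t * x ^ τ.leaves) (genFun x t) := fun t =>
    (summable_mAngle hx.le fun n => hle n t).hasSum
  have hlim : ∀ t, Tendsto (fun n => approx x n t) atTop (𝓝 (genFun x t)) := fun t =>
    (hsum t).comp tendsto_trees
  have hF0 : ∀ t, 0 ≤ genFun x t := fun t => ge_of_tendsto' (hlim t) (approx_nonneg hx.le · t)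
  have hFle : ∀ t, genFun x t ≤ sol c (max 0 (min t π)) := fun t =>
    le_of_tendsto' (hlim t) (hle · t)
  have hbdd : ∀ e, ∃ M, ∀ t ∈ Icc 0 π, |sol e t| ≤ M := fun e =>
    isCompact_Icc.exists_bound_of_continuousOn (continuous_sol e).continuousOn
  obtain ⟨M, hM⟩ := hbdd c
  have hsolM : ∀ t, sol c (max 0 (min t π)) ≤ M := fun t =>
    (le_abs_self _).trans (hM _ (clamp_mem t))
  have hFM : ∀ t, |genFun x t| ≤ M := fun t => by
    rw [abs_of_nonneg (hF0 t)]
    exact (hFle t).trans (hsolM t)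
  have haM : ∀ n t, |approx x n t| ≤ M := fun n t => by
    rw [abs_of_nonneg (approx_nonneg hx.le n t)]
    exact (hle n t).trans (hsolM t)
  have hmeas : Measurable (genFun x) :=
    measurable_of_tendsto_metrizable (fun n => (continuous_approx x n).measurable)
      (tendsto_pi_nhds.2 hlim)
  have hint : ∀ a b, IntervalIntegrable (genFun x) volume a b := fun a b =>
    (intervalIntegrable_const (c := M)).mono_fun hmeas.aestronglyMeasurable
      (Eventually.of_forall fun t => (hFM t).trans (le_abs_self M))
  have heq : ∀ t ∈ Icc 0 π,
      genFun x t = x + (tri (genFun x) (genFun x) π - tri (genFun x) (genFun x) t) := by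
    intro t ht
    refine tendsto_nhds_unique ((hlim t).comp (tendsto_add_atTop_nat 1)) ?_
    have htri := tendsto_tri (continuous_approx x) haM hlim
    refine (((htri π).sub (htri t)).const_add x).congr fun n => ?_
    have hcont := continuous_approx x n
    rw [Function.comp_apply, approx_succ, strip_eq_tri hcont hcont ht]
  set c' := genFun x 0 with hc'def
  have h0 := heq 0 ⟨le_rfl, hpi.le⟩
  have hπ := heq π ⟨hpi.le, le_rfl⟩
  rw [show tri (genFun x) (genFun x) 0 = 0 by simp [tri], ← hc'def, sub_zero] at h0
  rw [sub_self, add_zero] at hπ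
  have hvol : ∀ t ∈ Icc 0 π, genFun x t = c' - tri (genFun x) (genFun x) t := fun t ht => by
    rw [heq t ht, h0]
    ring
  obtain ⟨M', hM'⟩ := hbdd c'
  have hsol : ∀ t ∈ Icc 0 π, genFun x t = sol c' t := fun t ht =>
    volterra_unique hint (fun a b => (continuous_sol c').intervalIntegrable a b)
      (fun s _ => (hFM s).trans (le_max_left M M')) (fun s hs => (hM' s hs).trans (le_max_right _ _))
      hvol (fun s hs => sol_volterra c' hs.1) ht
  have hc'c : c' ≤ c := by
    have := hFle 0
    rwa [min_eq_left hpi.le, max_self, sol_zero] at this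
  have hc'0 : 0 ≤ c' := hF0 0
  have hcc : c' = c := strictMonoOn_Sfun.injOn ⟨hc'0, hc'c.trans hc'⟩ ⟨hc.le, hc'⟩ (by
    rw [← sol_pi hc'0, ← hsol π ⟨hpi.le, le_rfl⟩, hπ])
  rw [← hcc, ← hsol θ hθ]
  exact hsum θ

theorem hasSum_G {c : ℝ} (hc : 0 < c) (hc' : c ≤ (c0 / (2 * π)) ^ 2) {θ : ℝ}
    (hθ : θ ∈ Icc 0 π) : HasSum (fun n : ℕ => G (n + 1) θ * Sfun c ^ (n + 1)) (sol c θ) := by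
  have h := (hasSum_mAngle hc hc' hθ).tsum_fiberwise BinTree.leaves
  have hG : ∀ n : ℕ, ∑' τ : BinTree.leaves ⁻¹' {n}, mAngle τ θ * Sfun c ^ (τ : BinTree).leaves =
      G n θ * Sfun c ^ n := by
    intro n
    rw [G, ← tsum_mul_right]
    refine tsum_congr fun τ => ?_
    rw [show (τ : BinTree).leaves = n from τ.2]
  have hG0 : G 0 θ = 0 := by
    have : IsEmpty {τ : BinTree // τ.leaves = 0} :=
      ⟨fun τ => (leaves_pos τ.1).ne' τ.2⟩
    rw [G, tsum_empty]
  simp only [hG] at h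
  simpa [hG0] using (hasSum_nat_add_iff' 1).2 h

end Zograf

/-- Zograf's theorem in generating-function form (Theorem 3.2, eq. (eq:Fxtheta)):
for `c ∈ (0, (c₀/(2π))²]` and `θ ∈ (0,π]`, the series `∑_{n ≥ 1} G_n(θ) S(c)^n` sums to
`(√c/θ) J₁(2θ√c)`; for `θ = 0` it sums to `c`. In particular, with
`Z(x) = ∑_{n ≥ 1} G_n(0) x^n`, one has `S(Z(x)) = x` for all `x ∈ (0, x_c]`. -/
theorem zograf_generating_function :
    (∀ c : ℝ, 0 < c → c ≤ (c0 / (2 * Real.pi)) ^ 2 →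
      ((∀ θ : ℝ, 0 < θ → θ ≤ Real.pi →
          HasSum (fun n : ℕ => G (n + 1) θ * Sfun c ^ (n + 1))
            (Real.sqrt c / θ * J1 (2 * θ * Real.sqrt c))) ∧
        HasSum (fun n : ℕ => G (n + 1) 0 * Sfun c ^ (n + 1)) c)) ∧
    (∀ x : ℝ, 0 < x → x ≤ xc →
      Sfun (∑' n : ℕ, G (n + 1) 0 * x ^ (n + 1)) = x) := by
  constructor
  · intro c hc hc'
    refine ⟨fun θ hθ hθ' => ?_, ?_⟩
    · rw [Zograf.sol_eq_J1 hc.le hθ.ne']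
      exact Zograf.hasSum_G hc hc' ⟨hθ.le, hθ'⟩
    · simpa only [Zograf.sol_zero] using
        Zograf.hasSum_G hc hc' (θ := 0) ⟨le_rfl, Real.pi_pos.le⟩
  · intro x hx hx'
    obtain ⟨c, hc, hc', rfl⟩ := Zograf.exists_Sfun_eq hx hx'
    rw [(Zograf.hasSum_G hc hc' (θ := 0) ⟨le_rfl, Real.pi_pos.le⟩).tsum_eq, Zograf.sol_zero]
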